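/- arXiv:math/0011098 — 3 statements merged into one kernel-verified Lean document; each statement's English description precedes it below -/
import Mathlib

section
/- Assume moreover that k is algebraically closed. If there exists a maximal e-adapted partition P of I whose number of blocks is at most ⌊m/p⌋ + 1, then there exists an injective solution t : I → k for e, i.e., an injective family (t_i)_{i in I} of elements of k with sum_{i in I} e_i * t_i^ν = 0 in k for every integer ν with 1 ≤ ν ≤ m−1 and p ∤ ν. -/
open MvPolynomial in
theorem MvPolynomial.card_le_height_ker_rename {k I : Type*} [Field k] [Fintype I] [DecidableEq I]
    (g : I → I) (hg : ∀ i, g (g i) = g i) (S : Finset I) (hS : ∀ i ∈ S, g i ≠ i) :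
    (S.card : ℕ∞) ≤
      (RingHom.ker (rename (R := k) fun i ↦ if i ∈ S then g i else i)).height := by
  induction S using Finset.induction_on with
  | empty => simp
  | insert a S ha ih =>
    have key : (rename (R := k) fun i ↦ if i ∈ insert a S then g i else i) =
        (rename fun i ↦ if i ∈ insert a S then g i else i).comp
          (rename fun i ↦ if i ∈ S then g i else i) := by
      ext i : 1
      by_cases hi : i ∈ S
      · simp [hi, hg]
      · simp [hi]
    have hlt : RingHom.ker (rename (R := k) fun i ↦ if i ∈ S then g i else i) <
        RingHom.ker (rename (R := k) fun i ↦ if i ∈ insert a S then g i else i) := by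
      refine lt_of_le_of_ne (fun f hf ↦ ?_) fun h ↦ ?_
      · rw [RingHom.mem_ker] at hf ⊢
        rw [key, AlgHom.comp_apply, hf, map_zero]
      · have hmem : (X a - X (g a) : MvPolynomial I k) ∈
            RingHom.ker (rename (R := k) fun i ↦ if i ∈ insert a S then g i else i) := by
          simp [RingHom.mem_ker, hg]
        rw [← h, RingHom.mem_ker] at hmem
        simp only [map_sub, rename_X, if_neg ha, hg, ite_self, sub_eq_zero] at hmem
        exact hS a (Finset.mem_insert_self a S) (X_injective hmem).symm
    have := RingHom.ker_isPrime (rename (R := k) fun i ↦ if i ∈ S then g i else i)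
    have := RingHom.ker_isPrime (rename (R := k) fun i ↦ if i ∈ insert a S then g i else i)
    rw [Finset.card_insert_of_notMem ha]
    push_cast
    calc _ ≤ _ := add_le_add_left (ih fun i hi ↦ hS i (Finset.mem_insert_of_mem hi)) 1
      _ ≤ _ := Ideal.height_add_one_le_of_lt_of_isPrime hlt

open MvPolynomial in
theorem MvPolynomial.ker_rename_le {k I : Type*} [Field k] (g : I → I)
    (q : Ideal (MvPolynomial I k)) (hq : ∀ i, (X i - X (g i) : MvPolynomial I k) ∈ q) :
    RingHom.ker (rename (R := k) g) ≤ q := by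
  intro f hf
  have h : (Ideal.Quotient.mkₐ k q).comp (rename g) = Ideal.Quotient.mkₐ k q := by
    ext i : 1
    simpa using (Ideal.Quotient.eq.2 (hq i)).symm
  have := congrArg (fun φ ↦ φ f) h
  rw [RingHom.mem_ker] at hf
  rw [← Ideal.Quotient.eq_zero_iff_mem]
  simpa [hf] using this.symm

theorem sum_mul_pow_eq_zero_of_not_dvd {p : ℕ} [Fact p.Prime] {R I : Type*} [CommRing R]
    [CharP R p] [Fintype I] (c : ZMod p →+* R) (e : I → ZMod p)
    (hesum : ∑ i, e i = 0) (t : I → R) (n : ℕ)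
    (ht : ∀ ν, 1 ≤ ν → ν ≤ n → ¬ p ∣ ν → ∑ i, c (e i) * t i ^ ν = 0) (ν : ℕ) (hν : ν ≤ n) :
    ∑ i, c (e i) * t i ^ ν = 0 := by
  induction ν using Nat.strong_induction_on with
  | _ ν ih =>
    by_cases hd : p ∣ ν
    · obtain rfl | h0 := Nat.eq_zero_or_pos ν
      · simp [← map_sum, hesum]
      · obtain ⟨μ, rfl⟩ := hd
        have hp := (Fact.out : p.Prime)
        have hμ : μ < p * μ := by
          have := Nat.pos_of_mul_pos_left h0
          nlinarith [hp.two_le]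
        have := congrArg (· ^ p) (ih μ hμ (hμ.le.trans hν))
        simp only [sum_pow_char, mul_pow, ← map_pow, ZMod.pow_card, ← pow_mul,
          zero_pow hp.ne_zero] at this
        rw [← this]
        simp [mul_comm]
    · exact ht ν (Nat.one_le_iff_ne_zero.2 fun h ↦ hd (h ▸ dvd_zero p)) hν hd

open Polynomial in
theorem sum_fiber_eq_zero {R I : Type*} [CommRing R] [IsDomain R] [Fintype I] [DecidableEq R]
    (w t : I → R) (n : ℕ) (hn : (Finset.univ.image t).card ≤ n)
    (h : ∀ ν < n, ∑ i, w i * t i ^ ν = 0) (r : R) :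
    ∑ i with t i = r, w i = 0 := by
  by_cases hr : r ∈ Finset.univ.image t
  swap
  · refine Finset.sum_eq_zero fun i hi ↦ absurd ?_ hr
    simpa using ⟨i, (Finset.mem_filter.1 hi).2⟩
  have hpoly : ∀ f : R[X], f.natDegree < n → ∑ i, w i * f.eval (t i) = 0 := by
    intro f hf
    simp_rw [eval_eq_sum_range' hf, Finset.mul_sum]
    rw [Finset.sum_comm]
    refine Finset.sum_eq_zero fun ν hν ↦ ?_
    rw [← mul_zero (f.coeff ν), ← h ν (Finset.mem_range.1 hν), Finset.mul_sum]
    exact Finset.sum_congr rfl fun i _ ↦ by ring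
  set T := (Finset.univ.image t).erase r
  have hdeg : (∏ s ∈ T, (X - C s)).natDegree < n := by
    rw [natDegree_prod_of_monic _ _ fun s _ ↦ monic_X_sub_C s]
    simp only [natDegree_X_sub_C, Finset.sum_const, smul_eq_mul, mul_one]
    exact (Finset.card_erase_lt_of_mem hr).trans_le hn
  have := hpoly _ hdeg
  simp only [eval_prod, eval_sub, eval_X, eval_C] at this
  rw [← Finset.sum_filter_add_sum_filter_not _ (fun i ↦ t i = r),
    Finset.sum_congr rfl (g := fun i ↦ w i * ∏ s ∈ T, (r - s))
      fun i hi ↦ by rw [(Finset.mem_filter.1 hi).2],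
    ← Finset.sum_mul, Finset.sum_eq_zero (s := Finset.univ.filter fun i ↦ ¬ t i = r), add_zero,
    mul_eq_zero] at this
  · refine this.resolve_right (Finset.prod_ne_zero_iff.2 fun s hs ↦ ?_)
    exact sub_ne_zero.2 (Finset.ne_of_mem_erase hs).symm
  · intro i hi
    rw [Finset.prod_eq_zero (i := t i) _ (sub_self _), mul_zero]
    exact Finset.mem_erase.2 ⟨(Finset.mem_filter.1 hi).2, by simp⟩

theorem Nat.card_filter_not_dvd_Icc {p m : ℕ} (hm : 0 < m) (hpm : ¬ p ∣ m) :
    ((Finset.Icc 1 (m - 1)).filter fun ν ↦ ¬ p ∣ ν).card + m / p + 1 = m := by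
  obtain ⟨n, rfl⟩ := Nat.exists_eq_add_one.2 hm
  have h1 := Nat.Ioc_filter_dvd_card_eq_div n p
  have h2 := Finset.card_filter_add_card_filter_not (s := Finset.Ioc 0 n) (fun ν ↦ p ∣ ν)
  rw [Nat.succ_div, if_neg hpm]
  simp only [Nat.card_Ioc] at h2
  have h3 : Finset.Icc 1 n = Finset.Ioc 0 n := rfl
  simp only [Nat.add_sub_cancel, h3]
  omega

/-- A solution over a domain with a repeated value whose fibers refine a maximal adapted
partition is constant on the blocks of that partition. -/
theorem eq_of_mem_part_of_maximal {p : ℕ} [Fact p.Prime] {R I : Type*} [CommRing R] [IsDomain R]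
    [CharP R p] [Fintype I] [DecidableEq I] (c : ZMod p →+* R) (e : I → ZMod p)
    (hesum : ∑ i, e i = 0) (m : ℕ) (hI : Fintype.card I = m + 1)
    (P : Finpartition (Finset.univ : Finset I))
    (hPmax : ∀ Q : Finpartition (Finset.univ : Finset I),
      (∀ J ∈ Q.parts, ∑ i ∈ J, e i = 0) →
      (∀ J' ∈ Q.parts, ∃ J ∈ P.parts, J' ⊆ J) → Q = P)
    (t : I → R)
    (ht : ∀ ν, 1 ≤ ν → ν ≤ m - 1 → ¬ p ∣ ν → ∑ i, c (e i) * t i ^ ν = 0)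
    (hinj : ¬ Function.Injective t) (htP : ∀ i j, t i = t j → j ∈ P.part i)
    {i j : I} (hij : j ∈ P.part i) : t i = t j := by
  classical
  have hcard : (Finset.univ.image t).card ≤ m := by
    have h1 : (Finset.univ.image t).card ≤ m + 1 := hI ▸ Finset.card_image_le
    have h2 : (Finset.univ.image t).card ≠ m + 1 := fun h ↦ hinj <| by
      rw [← Set.injOn_univ, ← Finset.coe_univ, ← Finset.card_image_iff, h, Finset.card_univ, hI]
    omega
  have hsum := sum_fiber_eq_zero (fun i ↦ c (e i)) t m hcard fun ν hν ↦
    sum_mul_pow_eq_zero_of_not_dvd c e hesum t (m - 1) ht ν (by omega)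
  let Q := Finpartition.ofSetoid (Setoid.ker t)
  have hQ : ∀ a b, b ∈ Q.part a ↔ t a = t b := fun a b ↦ Finpartition.mem_part_ofSetoid_iff_rel
  have hparts : ∀ J ∈ Q.parts, ∃ a, J = Q.part a := fun J hJ ↦ by
    obtain ⟨a, -, h⟩ := Q.part_surjOn hJ
    exact ⟨a, h.symm⟩
  have hQP : Q = P := by
    refine hPmax Q (fun J hJ ↦ ?_) fun J hJ ↦ ?_
    · obtain ⟨a, rfl⟩ := hparts J hJ
      apply c.injective
      rw [map_sum, map_zero, ← hsum (t a)]
      refine Finset.sum_congr ?_ fun _ _ ↦ rfl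
      ext b
      simp [hQ, eq_comm]
    · obtain ⟨a, rfl⟩ := hparts J hJ
      exact ⟨P.part a, P.part_mem.2 (Finset.mem_univ a), fun b hb ↦ htP a b ((hQ a b).1 hb)⟩
  rwa [← hQ, hQP]

/-- A choice of representatives for the blocks of a partition. -/
theorem Finpartition.exists_representative {I : Type*} [Fintype I] [DecidableEq I]
    (P : Finpartition (Finset.univ : Finset I)) :
    ∃ g : I → I, (∀ i j, g i = g j ↔ j ∈ P.part i) ∧ (∀ i, g (g i) = g i) ∧
      Fintype.card I ≤ (Finset.univ.filter fun i ↦ g i ≠ i).card + P.parts.card := by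
  have hne : ∀ J : Finset I, J ∈ P.parts → ∃ j, j ∈ J := fun J hJ ↦ P.nonempty_of_mem_parts hJ
  choose f hf using hne
  have hmem : ∀ i, P.part i ∈ P.parts := fun i ↦ P.part_mem.2 (Finset.mem_univ i)
  have hpart : ∀ i j, P.part i = P.part j ↔ j ∈ P.part i := fun i j ↦
    eq_comm.trans (P.part_eq_iff_mem (hmem i))
  let g : I → I := fun i ↦ f (P.part i) (hmem i)
  have hg : ∀ i, P.part i = P.part (g i) := fun i ↦ (hpart _ _).2 (hf _ _)
  have hgg : ∀ i j, P.part i = P.part j → g i = g j := fun i j h ↦ by simp only [g, h]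
  refine ⟨g, fun i j ↦ ?_, fun i ↦ hgg _ _ (hg i).symm, ?_⟩
  · rw [← hpart]
    exact ⟨fun h ↦ by rw [hg i, hg j, h], hgg i j⟩
  · have h1 := Finset.card_filter_add_card_filter_not (s := (Finset.univ : Finset I))
      (fun i ↦ g i = i)
    have h2 : (Finset.univ.filter fun i ↦ g i = i).card ≤ P.parts.card := by
      refine Finset.card_le_card_of_injOn P.part (fun i _ ↦ hmem i) fun i hi j hj h ↦ ?_
      have hi : g i = i := by simpa using hi
      have hj : g j = j := by simpa using hj
      rw [← hi, ← hj, hgg i j h]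
    rw [Finset.card_univ] at h1
    simp only [ne_eq]
    omega
open MvPolynomial in
/-- If `k` is algebraically closed and there exists a maximal `e`-adapted
partition of `I` with at most `⌊m/p⌋ + 1` blocks, then there exists an injective solution
`t : I → k` for `e`. -/
theorem stmt_3 {p : ℕ} (hp : p.Prime) (k : Type*) [Field k] [IsAlgClosed k] [CharP k p]
    (m : ℕ) (hm : 0 < m) (hpm : ¬ p ∣ m)
    (I : Type*) [Fintype I] [DecidableEq I] (hI : Fintype.card I = m + 1)
    (e : I → ZMod p) (he : ∀ i, e i ≠ 0) (hesum : ∑ i, e i = 0)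
    (P : Finpartition (Finset.univ : Finset I))
    (hPad : ∀ J ∈ P.parts, ∑ i ∈ J, e i = 0)
    (hPmax : ∀ Q : Finpartition (Finset.univ : Finset I),
      (∀ J ∈ Q.parts, ∑ i ∈ J, e i = 0) →
      (∀ J' ∈ Q.parts, ∃ J ∈ P.parts, J' ⊆ J) → Q = P)
    (hcard : P.parts.card ≤ m / p + 1) :
    ∃ t : I → k, Function.Injective t ∧
      ∀ ν : ℕ, 1 ≤ ν → ν ≤ m - 1 → ¬ p ∣ ν →
        ∑ i, (ZMod.castHom (dvd_refl p) k (e i)) * t i ^ ν = 0 := by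
  classical
  have : Fact p.Prime := ⟨hp⟩
  by_contra hno
  obtain ⟨g, hgP, hgg, hgcard⟩ := P.exists_representative
  let F : ℕ → MvPolynomial I k := fun ν ↦
    ∑ i, C (ZMod.castHom (dvd_refl p) k (e i)) * X i ^ ν
  let N : Finset ℕ := (Finset.Icc 1 (m - 1)).filter fun ν ↦ ¬ p ∣ ν
  let G : Finset (MvPolynomial I k) := N.image F
  let 𝔭 : Ideal (MvPolynomial I k) := RingHom.ker (rename (R := k) g)
  have h𝔭 : 𝔭.IsPrime := RingHom.ker_isPrime _
  have hG𝔭 : Ideal.span (G : Set (MvPolynomial I k)) ≤ 𝔭 := by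
    rw [Ideal.span_le]
    intro f hf
    obtain ⟨ν, -, rfl⟩ := Finset.mem_image.1 (Finset.mem_coe.1 hf)
    simp only [𝔭, F, SetLike.mem_coe, RingHom.mem_ker, map_sum, map_mul, rename_C, map_pow,
      rename_X]
    rw [← Finset.sum_fiberwise_of_maps_to (t := Finset.univ) (g := g) fun _ _ ↦ Finset.mem_univ _]
    refine Finset.sum_eq_zero fun j _ ↦ ?_
    rw [Finset.sum_congr rfl (g := fun i ↦ C (ZMod.castHom (dvd_refl p) k (e i)) * X j ^ ν)
      fun i hi ↦ by rw [(Finset.mem_filter.1 hi).2], ← Finset.sum_mul, ← map_sum, ← map_sum]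
    obtain h | ⟨i, hi⟩ := (Finset.univ.filter fun i ↦ g i = j).eq_empty_or_nonempty
    · simp [h]
    · have : (Finset.univ.filter fun i ↦ g i = j) = P.part i := by
        ext l
        simp only [Finset.mem_filter, Finset.mem_univ, true_and] at hi ⊢
        rw [← hgP, hi, eq_comm]
      rw [this, hPad _ (P.part_mem.2 (Finset.mem_univ i))]
      simp
  have hmin : 𝔭 ∈ (Ideal.span (G : Set (MvPolynomial I k))).minimalPrimes := by
    refine ⟨⟨h𝔭, hG𝔭⟩, fun 𝔮 ⟨h𝔮, hG𝔮⟩ h𝔮𝔭 ↦ ?_⟩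
    let R := MvPolynomial I k ⧸ 𝔮
    let t : I → R := fun i ↦ Ideal.Quotient.mk 𝔮 (X i)
    have htX : ∀ i j, t i = t j ↔ (X i - X j : MvPolynomial I k) ∈ 𝔮 := fun i j ↦
      Ideal.Quotient.eq
    have hchar : CharP R p := charP_of_injective_algebraMap (algebraMap k R).injective p
    have ht : ∀ ν, 1 ≤ ν → ν ≤ m - 1 → ¬ p ∣ ν →
        ∑ i, ((algebraMap k R).comp (ZMod.castHom (dvd_refl p) k)) (e i) * t i ^ ν = 0 := by
      intro ν h1 h2 h3
      have : F ν ∈ 𝔮 := hG𝔮 <| Ideal.subset_span <| Finset.mem_coe.2 <|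
        Finset.mem_image_of_mem _ (by simp [N, h1, h2, h3])
      rw [← Ideal.Quotient.eq_zero_iff_mem] at this
      rw [← this, map_sum]
      exact Finset.sum_congr rfl fun i _ ↦ by rw [map_mul, map_pow]; rfl
    have hninj : ¬ Function.Injective t := by
      have hΔ : (∏ x ∈ (Finset.univ : Finset I).offDiag, (X x.1 - X x.2 : MvPolynomial I k)) ∈
          𝔮 := by
        apply h𝔮.radical_le_iff.2 hG𝔮
        rw [← vanishingIdeal_zeroLocus_eq_radical (K := k), mem_vanishingIdeal_iff]
        intro x hx
        rw [zeroLocus_span] at hx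
        by_contra h
        refine hno ⟨x, fun i j hij ↦ by_contra fun hne ↦ h ?_, fun ν h1 h2 h3 ↦ ?_⟩
        · rw [map_prod]
          exact Finset.prod_eq_zero (i := (i, j)) (by simp [hne]) (by simp [hij])
        · have := hx (F ν) (Finset.mem_coe.2 <|
            Finset.mem_image_of_mem _ (by simp [N, h1, h2, h3]))
          simpa [F] using this
      obtain ⟨x, hx, hx𝔮⟩ := (h𝔮.prod_mem_iff).1 hΔ
      exact fun h ↦ (Finset.mem_offDiag.1 hx).2.2 (h ((htX _ _).2 hx𝔮))
    refine MvPolynomial.ker_rename_le g 𝔮 fun i ↦ ?_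
    rw [← htX]
    refine eq_of_mem_part_of_maximal _ e hesum m hI P hPmax t ht hninj (fun i j hij ↦ ?_)
      ((hgP _ _).1 (hgg i).symm)
    have := h𝔮𝔭 ((htX i j).1 hij)
    simp only [𝔭, RingHom.mem_ker, map_sub, rename_X, sub_eq_zero] at this
    exact (hgP i j).1 (X_injective this)
  have hle := Ideal.height_le_card_of_mem_minimalPrimes_span_finset hmin
  have hge := MvPolynomial.card_le_height_ker_rename (k := k) g hgg
    (Finset.univ.filter fun i ↦ g i ≠ i) (by simp)
  have hgeq : (fun i ↦ if i ∈ Finset.univ.filter (fun i ↦ g i ≠ i) then g i else i) = g := by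
    ext i
    by_cases h : g i = i <;> simp [h]
  rw [hgeq] at hge
  have h1 : (Finset.univ.filter fun i ↦ g i ≠ i).card ≤ G.card := by
    exact_mod_cast hge.trans hle
  have h2 : G.card ≤ N.card := Finset.card_image_le
  have h3 : N.card + m / p + 1 = m := Nat.card_filter_not_dvd_Icc hm hpm
  omega
end

section
/- Assume moreover that k is algebraically closed. If there exists a maximal e-adapted partition of I with at most ⌊m/p⌋ + 1 blocks, then there exists an injective family t : I → k such that sum_{i in I} e_i * t_i^ν = 0 in k for every integer ν with 1 ≤ ν ≤ m−1 (including the ν divisible by p), and sum_{i in I} e_i * t_i^m ≠ 0 in k. (Choosing integer representatives h_i of the e_i with sum h_i = 0, this says exactly that the logarithmic differential du/u of u = prod_{i in I} (X − t_i)^{h_i} in k(X) has divisor (m−1)·[∞] − sum_{i in I} [t_i], with residue e_i at t_i; this is the realizability criterion for a multiplicative vertex of a Hurwitz tree.) -/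
open MvPolynomial in
/-- The ideal of the linear subspace of families factoring through `f` has height at least its
codimension. -/
theorem card_le_height_ker_rename {k I : Type*} [Field k] [Fintype I] {J : Type*} [DecidableEq J]
    (f : I → J) :
    (Fintype.card I : ℕ∞) ≤
      (RingHom.ker (rename f : MvPolynomial I k →ₐ[k] MvPolynomial J k)).height +
        (Finset.univ.image f).card := by
  classical
  by_cases hf : Function.Injective f
  · rw [Finset.card_image_of_injective _ hf, Finset.card_univ]
    exact le_add_self
  · obtain ⟨a, b, hab, hne⟩ := Function.not_injective_iff.mp hf
    let f' : I → Option J := Function.update (fun i => some (f i)) a none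
    have hfac : f = (fun o : Option J => o.getD (f a)) ∘ f' := by
      funext i
      by_cases h : i = a <;> simp [f', h]
    have himg : Finset.univ.image f' = insert none ((Finset.univ.image f).image some) := by
      ext o
      cases o with
      | none => simpa [f'] using ⟨a, by simp⟩
      | some j =>
        simp only [Finset.mem_image, Finset.mem_univ, true_and, Finset.mem_insert,
          reduceCtorEq, false_or, Option.some.injEq, exists_eq_right, f']
        constructor
        · rintro ⟨i, hi⟩
          by_cases h : i = a
          · simp [h] at hi
          · exact ⟨i, by simpa [h] using hi⟩
        · rintro ⟨i, rfl⟩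
          by_cases h : i = a
          · exact ⟨b, by simp [Ne.symm hne, h, hab]⟩
          · exact ⟨i, by simp [h]⟩
    have hcard : (Finset.univ.image f').card = (Finset.univ.image f).card + 1 := by
      rw [himg, Finset.card_insert_of_notMem (by simp),
        Finset.card_image_of_injective _ (Option.some_injective J)]
    have hlt : RingHom.ker (rename f' : MvPolynomial I k →ₐ[k] MvPolynomial (Option J) k) <
        RingHom.ker (rename f : MvPolynomial I k →ₐ[k] MvPolynomial J k) := by
      refine lt_of_le_of_ne (fun q hq => ?_) fun heq => ?_
      · rw [RingHom.mem_ker] at hq ⊢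
        rw [hfac, ← rename_rename, hq, map_zero]
      · have hmem : (X a - X b : MvPolynomial I k) ∈
            RingHom.ker (rename f : MvPolynomial I k →ₐ[k] MvPolynomial J k) := by
          simp [RingHom.mem_ker, hab]
        rw [← heq, RingHom.mem_ker, map_sub, rename_X, rename_X, sub_eq_zero] at hmem
        have := X_injective hmem
        simp [f', Ne.symm hne] at this
    have : (RingHom.ker (rename f' : MvPolynomial I k →ₐ[k] MvPolynomial (Option J) k)).IsPrime :=
      RingHom.ker_isPrime _
    have : (RingHom.ker (rename f : MvPolynomial I k →ₐ[k] MvPolynomial J k)).IsPrime :=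
      RingHom.ker_isPrime _
    calc (Fintype.card I : ℕ∞) ≤ _ := card_le_height_ker_rename f'
      _ = (RingHom.ker (rename f' : MvPolynomial I k →ₐ[k] MvPolynomial (Option J) k)).height + 1 +
            (Finset.univ.image f).card := by
          rw [hcard]; push_cast; ring
      _ ≤ _ := by
          gcongr
          exact Ideal.height_add_one_le_of_lt_of_isPrime hlt
termination_by Fintype.card I - (Finset.univ.image f).card
decreasing_by
  have h1 : (Finset.univ.image f').card ≤ Fintype.card I := Finset.card_image_le
  have h2 := hcard
  simp only [f'] at h1 h2
  omega

open Polynomial in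
/-- If sufficiently many weighted power sums of `t` vanish, so does the total weight of every
fiber of `t`. -/
theorem sum_fiber_eq_zero_of_sum_mul_pow {k I : Type*} [Field k] [DecidableEq k] [Fintype I]
    (w t : I → k)
    (h : ∀ ν < (Finset.univ.image t).card, ∑ i, w i * t i ^ ν = 0) (x : k) :
    ∑ i with t i = x, w i = 0 := by
  by_cases hx : x ∈ Finset.univ.image t
  swap
  · rw [Finset.filter_false_of_mem, Finset.sum_empty]
    rintro i - rfl
    exact hx (Finset.mem_image_of_mem t (Finset.mem_univ i))
  let g : k[X] := ∏ y ∈ (Finset.univ.image t).erase x, (X - C y)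
  have hdeg : g.natDegree < (Finset.univ.image t).card := by
    rw [natDegree_finsetProd_X_sub_C_eq_card]
    exact Finset.card_erase_lt_of_mem hx
  have hg : ∑ i, w i * g.eval (t i) = 0 := by
    simp_rw [eval_eq_sum_range' hdeg, Finset.mul_sum]
    rw [Finset.sum_comm]
    refine Finset.sum_eq_zero fun ν hν => ?_
    simp_rw [mul_left_comm (w _), ← Finset.mul_sum]
    rw [h ν (Finset.mem_range.mp hν), mul_zero]
  have hne : ∀ i, t i ≠ x → g.eval (t i) = 0 := fun i hi => by
    rw [eval_prod]
    exact Finset.prod_eq_zero (i := t i) (by simp [hi]) (by simp)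
  have hgx : g.eval x ≠ 0 := by
    rw [eval_prod, Finset.prod_ne_zero_iff]
    intro y hy
    simpa [sub_eq_zero] using (Finset.ne_of_mem_erase hy).symm
  have : (∑ i with t i = x, w i) * g.eval x = 0 := by
    rw [← hg, Finset.sum_filter, Finset.sum_mul]
    refine Finset.sum_congr rfl fun i _ => ?_
    split_ifs with hi
    · rw [hi]
    · rw [hne i hi, zero_mul, mul_zero]
  exact (mul_eq_zero.mp this).resolve_right hgx

/-- Weighted power sums with weights in the prime field vanish for all exponents below `m` once
they do for the exponents prime to `p`. -/
theorem sum_castHom_mul_pow_eq_zero {p : ℕ} (hp : p.Prime) {k : Type*} [Field k]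
    [CharP k p] {I : Type*} [Fintype I] (e : I → ZMod p) (t : I → k) {m : ℕ}
    (h : ∀ ν : ℕ, 0 < ν → ν < m → ¬ p ∣ ν →
      ∑ i, ZMod.castHom (dvd_refl p) k (e i) * t i ^ ν = 0)
    (ν : ℕ) (hν : 0 < ν) (hνm : ν < m) :
    ∑ i, ZMod.castHom (dvd_refl p) k (e i) * t i ^ ν = 0 := by
  have : Fact p.Prime := ⟨hp⟩
  induction ν using Nat.strong_induction_on with
  | _ ν ih =>
    by_cases hd : p ∣ ν
    · obtain ⟨n, rfl⟩ := hd
      have hn : 0 < n := Nat.pos_of_mul_pos_left hν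
      have hlt : n < p * n := lt_mul_of_one_lt_left hn hp.one_lt
      rw [← zero_pow (M₀ := k) hp.ne_zero, ← ih n hlt hn (hlt.trans hνm), sum_pow_char]
      refine Finset.sum_congr rfl fun i _ => ?_
      rw [mul_pow, ← map_pow, ZMod.pow_card, ← pow_mul, mul_comm n p]
    · exact h ν hν hνm hd

theorem card_filter_not_dvd_Ioc {p m : ℕ} (hm : 0 < m) (hpm : ¬ p ∣ m) :
    ((Finset.Ioc 0 (m - 1)).filter (¬ p ∣ ·)).card + m / p + 1 = m := by
  obtain ⟨n, rfl⟩ : ∃ n, m = n + 1 := ⟨m - 1, by omega⟩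
  have h := Finset.card_filter_add_card_filter_not (s := Finset.Ioc 0 n) (p ∣ ·)
  rw [Nat.Ioc_filter_dvd_card_eq_div, Nat.card_Ioc] at h
  rw [Nat.succ_div, if_neg hpm]
  simp only [Nat.add_sub_cancel]
  omega

namespace Finpartition

variable {I : Type*} [Fintype I] [DecidableEq I]

theorem image_part_univ (P : Finpartition (Finset.univ : Finset I)) :
    Finset.univ.image P.part = P.parts := by
  ext J
  simp only [Finset.mem_image, Finset.mem_univ, true_and]
  constructor
  · rintro ⟨i, rfl⟩
    exact P.part_mem.mpr (Finset.mem_univ i)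
  · intro hJ
    obtain ⟨i, hi⟩ := P.nonempty_of_mem_parts hJ
    exact ⟨i, P.part_eq_of_mem hJ hi⟩

theorem sum_filter_part_eq_zero {M : Type*} [AddCommMonoid M]
    (P : Finpartition (Finset.univ : Finset I)) (w : I → M)
    (h : ∀ J ∈ P.parts, ∑ i ∈ J, w i = 0) (J : Finset I) :
    ∑ i with P.part i = J, w i = 0 := by
  by_cases hJ : J ∈ P.parts
  · simpa [P.part_eq_iff_mem hJ] using h J hJ
  · rw [Finset.filter_false_of_mem, Finset.sum_empty]
    rintro i - rfl
    exact hJ (P.part_mem.mpr (Finset.mem_univ i))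

theorem sum_mul_comp_part_eq_zero {R : Type*} [NonUnitalNonAssocSemiring R]
    (P : Finpartition (Finset.univ : Finset I)) (w : I → R)
    (h : ∀ J ∈ P.parts, ∑ i ∈ J, w i = 0) (s : Finset I → R) :
    ∑ i, w i * s (P.part i) = 0 := by
  rw [← Finset.sum_fiberwise Finset.univ P.part]
  refine Finset.sum_eq_zero fun J _ => ?_
  trans (∑ i with P.part i = J, w i) * s J
  · rw [Finset.sum_mul]
    refine Finset.sum_congr rfl fun i hi => ?_
    rw [(Finset.mem_filter.mp hi).2]
  · rw [P.sum_filter_part_eq_zero w h, zero_mul]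

/-- If elements in the same part of `P` lie in the same part of `Q`, then `P` refines `Q`. -/
theorem exists_superset_of_part_eq_imp {P Q : Finpartition (Finset.univ : Finset I)}
    (h : ∀ a b, P.part a = P.part b → Q.part a = Q.part b) :
    ∀ J ∈ P.parts, ∃ J' ∈ Q.parts, J ⊆ J' := by
  intro J hJ
  obtain ⟨a, ha⟩ := P.nonempty_of_mem_parts hJ
  refine ⟨Q.part a, Q.part_mem.mpr (Finset.mem_univ a), fun b hb => ?_⟩
  rw [Q.mem_part_iff_part_eq_part (Finset.mem_univ _) (Finset.mem_univ _)]
  apply h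
  rw [P.part_eq_of_mem hJ ha, P.part_eq_of_mem hJ hb]

end Finpartition

open MvPolynomial in
/-- If the non-injective solutions of a system of weighted power sums have fibers of total weight
zero, and `P` is a maximal adapted partition with few blocks, then there is an injective
solution. -/
theorem exists_injective_sum_mul_pow_eq_zero {k : Type*} [Field k] [IsAlgClosed k]
    [DecidableEq k] {I : Type*} [Fintype I] [DecidableEq I] (w : I → k) (S : Finset ℕ)
    (P : Finpartition (Finset.univ : Finset I))
    (hPad : ∀ J ∈ P.parts, ∑ i ∈ J, w i = 0)
    (hPmax : ∀ Q : Finpartition (Finset.univ : Finset I),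
      (∀ J ∈ Q.parts, ∑ i ∈ J, w i = 0) →
      (∀ J' ∈ Q.parts, ∃ J ∈ P.parts, J' ⊆ J) → Q = P)
    (hfib : ∀ t : I → k, ¬ Function.Injective t →
      (∀ ν ∈ S, ∑ i, w i * t i ^ ν = 0) → ∀ x, ∑ i with t i = x, w i = 0)
    (hcard : S.card + P.parts.card < Fintype.card I) :
    ∃ t : I → k, Function.Injective t ∧ ∀ ν ∈ S, ∑ i, w i * t i ^ ν = 0 := by
  classical
  by_contra! hno
  let F : ℕ → MvPolynomial I k := fun ν => ∑ i, C (w i) * X i ^ ν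
  let 𝔞 : Ideal (MvPolynomial I k) := Ideal.span (S.image F : Finset (MvPolynomial I k))
  let K (Q : Finpartition (Finset.univ : Finset I)) : Ideal (MvPolynomial I k) :=
    RingHom.ker (rename Q.part : MvPolynomial I k →ₐ[k] MvPolynomial (Finset I) k)
  have hKprime (Q) : (K Q).IsPrime := RingHom.ker_isPrime _
  have h𝔞P : 𝔞 ≤ K P := by
    refine Ideal.span_le.mpr fun q hq => ?_
    obtain ⟨ν, -, rfl⟩ := Finset.mem_image.mp (Finset.mem_coe.mp hq)
    simp only [K, F, SetLike.mem_coe, RingHom.mem_ker, map_sum, map_mul, map_pow, rename_C,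
      rename_X]
    refine P.sum_mul_comp_part_eq_zero (fun i => (C (w i) : MvPolynomial (Finset I) k))
      (fun J hJ => ?_) fun J => X J ^ ν
    rw [← map_sum, hPad J hJ, map_zero]
  let 𝒬 : Finset (Finpartition (Finset.univ : Finset I)) :=
    Finset.univ.filter fun Q => ∀ J ∈ Q.parts, ∑ i ∈ J, w i = 0
  have hrad : 𝒬.inf K ≤ 𝔞.radical := by
    rw [← vanishingIdeal_zeroLocus_eq_radical (K := k)]
    intro q hq t ht
    have hsol : ∀ ν ∈ S, ∑ i, w i * t i ^ ν = 0 := fun ν hν => by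
      simpa [F] using
        ht (F ν) (Ideal.subset_span (Finset.mem_coe.mpr (Finset.mem_image_of_mem F hν)))
    have hinj : ¬ Function.Injective t := fun hinj => by
      obtain ⟨ν, hν, hne⟩ := hno t hinj
      exact hne (hsol ν hν)
    let Q : Finpartition (Finset.univ : Finset I) := Finpartition.ofSetoid (Setoid.ker t)
    have hmem (a b : I) : b ∈ Q.part a ↔ t a = t b := by
      rw [Finpartition.mem_part_ofSetoid_iff_rel, Setoid.ker_def]
    have hQ : Q ∈ 𝒬 := by
      refine Finset.mem_filter.mpr ⟨Finset.mem_univ _, fun J hJ => ?_⟩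
      obtain ⟨a, ha⟩ := Q.nonempty_of_mem_parts hJ
      rw [← hfib t hinj hsol (t a), ← Q.part_eq_of_mem hJ ha]
      refine Finset.sum_congr ?_ fun _ _ => rfl
      ext b
      simp [hmem, eq_comm]
    have hfac : t.FactorsThrough Q.part := fun a b hab => by
      rw [← hmem, hab, Q.mem_part_self]
      exact Finset.mem_univ b
    have hqQ : rename Q.part q = 0 := Finset.inf_le (f := K) hQ hq
    have hext : Function.extend Q.part t 0 ∘ Q.part = t := funext fun a => hfac.extend_apply 0 a
    rw [← hext, ← aeval_rename, hqQ, map_zero]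
  have hmin : K P ∈ 𝔞.minimalPrimes := by
    refine ⟨⟨hKprime P, h𝔞P⟩, fun 𝔮 ⟨h𝔮, h𝔞𝔮⟩ h𝔮P => ?_⟩
    obtain ⟨Q, hQ, hQ𝔮⟩ := h𝔮.inf_le'.mp (hrad.trans (h𝔮.radical_le_iff.mpr h𝔞𝔮))
    have hQP : Q = P := by
      refine hPmax Q (Finset.mem_filter.mp hQ).2
        (Finpartition.exists_superset_of_part_eq_imp fun a b hab => ?_)
      have hmem : (X a - X b : MvPolynomial I k) ∈ K Q := by
        simp [K, RingHom.mem_ker, hab]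
      have := h𝔮P (hQ𝔮 hmem)
      simp only [K, RingHom.mem_ker, map_sub, rename_X, sub_eq_zero] at this
      exact X_injective this
    exact hQP ▸ hQ𝔮
  have hupper : (K P).height ≤ S.card :=
    (Ideal.height_le_card_of_mem_minimalPrimes_span_finset hmin).trans
      (by exact_mod_cast Finset.card_image_le)
  have hlower := card_le_height_ker_rename (k := k) P.part
  rw [P.image_part_univ] at hlower
  have : (Fintype.card I : ℕ∞) ≤ S.card + P.parts.card := hlower.trans (by gcongr)
  exact absurd (by exact_mod_cast this) hcard.not_ge

/-- If `k` is algebraically closed and there exists a maximal `e`-adapted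
partition of `I` with at most `⌊m/p⌋ + 1` blocks, then there exists an injective family
`t : I → k` with `∑ i, e i * t i ^ ν = 0` for all `1 ≤ ν ≤ m − 1` (including the `ν`
divisible by `p`) and `∑ i, e i * t i ^ m ≠ 0`. -/
theorem stmt_5 {p : ℕ} (hp : p.Prime) (k : Type*) [Field k] [IsAlgClosed k] [CharP k p]
    (m : ℕ) (hm : 0 < m) (hpm : ¬ p ∣ m)
    (I : Type*) [Fintype I] [DecidableEq I] (hI : Fintype.card I = m + 1)
    (e : I → ZMod p) (he : ∀ i, e i ≠ 0) (hesum : ∑ i, e i = 0)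
    (P : Finpartition (Finset.univ : Finset I))
    (hPad : ∀ J ∈ P.parts, ∑ i ∈ J, e i = 0)
    (hPmax : ∀ Q : Finpartition (Finset.univ : Finset I),
      (∀ J ∈ Q.parts, ∑ i ∈ J, e i = 0) →
      (∀ J' ∈ Q.parts, ∃ J ∈ P.parts, J' ⊆ J) → Q = P)
    (hcard : P.parts.card ≤ m / p + 1) :
    ∃ t : I → k, Function.Injective t ∧
      (∀ ν : ℕ, 1 ≤ ν → ν ≤ m - 1 →
        ∑ i, (ZMod.castHom (dvd_refl p) k (e i)) * t i ^ ν = 0) ∧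
      ∑ i, (ZMod.castHom (dvd_refl p) k (e i)) * t i ^ m ≠ 0 := by
  classical
  let φ := ZMod.castHom (dvd_refl p) k
  have : Fact p.Prime := ⟨hp⟩
  have hφ : Function.Injective φ := φ.injective
  have hsum (J : Finset I) : ∑ i ∈ J, φ (e i) = 0 ↔ ∑ i ∈ J, e i = 0 := by
    rw [← map_sum, map_eq_zero_iff φ hφ]
  let S := (Finset.Ioc 0 (m - 1)).filter (¬ p ∣ ·)
  have hpow (t : I → k) (ht : ∀ ν ∈ S, ∑ i, φ (e i) * t i ^ ν = 0) (ν : ℕ) (hν : ν < m) :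
      ∑ i, φ (e i) * t i ^ ν = 0 := by
    rcases Nat.eq_zero_or_pos ν with rfl | hpos
    · simpa using (hsum Finset.univ).mpr hesum
    · refine sum_castHom_mul_pow_eq_zero hp e t (fun μ hμ hμm hd => ht μ ?_) ν hpos hν
      exact Finset.mem_filter.mpr ⟨Finset.mem_Ioc.mpr ⟨hμ, by omega⟩, hd⟩
  obtain ⟨t, hinj, ht⟩ := exists_injective_sum_mul_pow_eq_zero (fun i => φ (e i)) S P
    (fun J hJ => (hsum J).mpr (hPad J hJ))
    (fun Q hQ => hPmax Q fun J hJ => (hsum J).mp (hQ J hJ))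
    (fun t hninj ht => sum_fiber_eq_zero_of_sum_mul_pow _ t fun ν hν => hpow t ht ν <| by
      have hlt : (Finset.univ.image t).card < Fintype.card I :=
        lt_of_le_of_ne Finset.card_image_le fun h =>
          hninj (by simpa using Finset.card_image_iff.mp h)
      omega)
    (by
      have : S.card + m / p + 1 = m := card_filter_not_dvd_Ioc hm hpm
      omega)
  refine ⟨t, hinj, fun ν _ hν => hpow t ht ν (by omega), fun htm => ?_⟩
  obtain ⟨i⟩ : Nonempty I := Fintype.card_pos_iff.mp (by omega)
  have hi := sum_fiber_eq_zero_of_sum_mul_pow (fun i => φ (e i)) t (fun ν hν => by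
    rw [Finset.card_image_of_injective _ hinj, Finset.card_univ, hI, Nat.lt_succ_iff] at hν
    rcases hν.eq_or_lt with rfl | hν
    · exact htm
    · exact hpow t ht ν hν) (t i)
  simp only [hinj.eq_iff, Finset.filter_eq', Finset.mem_univ, if_true,
    Finset.sum_singleton] at hi
  exact he i ((map_eq_zero_iff φ hφ).mp hi)
end

section
/- If there exists a maximal e-adapted partition of I with at most ⌊m/p⌋ + 1 blocks, then there exists an injective family t : I → k such that sum_{i in I} e_i * t_i^ν = 0 in k for every integer ν with 1 ≤ ν ≤ m−1, and sum_{i in I} e_i * t_i^m ≠ 0 in k. (This says exactly that the rational function u = prod_{j in J}(X − t_j) / prod_{a in I'}(X − t_a)^{m'_a} in k(X) has exact differential du with divisor (m−1)·[∞] − sum_{a in I'} (m'_a + 1)·[t_a]; this is the realizability criterion for an additive vertex of a Hurwitz tree.) -/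
open MvPolynomial in
/-- The ideal of polynomials vanishing on the linear subspace `{t | t = t ∘ f}`. -/
noncomputable abbrev collapseIdeal {σ : Type*} (K : Type*) [Field K] (f : σ → σ) :
    Ideal (MvPolynomial σ K) :=
  RingHom.ker (rename f : MvPolynomial σ K →ₐ[K] MvPolynomial σ K)

instance {σ K : Type*} [Field K] (f : σ → σ) : (collapseIdeal K f).IsPrime :=
  RingHom.ker_isPrime _

theorem collapseIdeal_le_of_comp_eq {σ K : Type*} [Field K] {f g : σ → σ} (h : f ∘ g = f) :
    collapseIdeal K g ≤ collapseIdeal K f := by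
  intro q hq
  have hq' : MvPolynomial.rename g q = 0 := hq
  change MvPolynomial.rename f q = 0
  rw [← h, ← MvPolynomial.rename_rename, hq', map_zero]

theorem X_sub_X_mem_collapseIdeal_iff {σ K : Type*} [Field K] {f : σ → σ} {i j : σ} :
    (MvPolynomial.X i - MvPolynomial.X j : MvPolynomial σ K) ∈ collapseIdeal K f ↔ f i = f j := by
  rw [RingHom.mem_ker, map_sub, MvPolynomial.rename_X, MvPolynomial.rename_X, sub_eq_zero]
  exact (MvPolynomial.X_injective).eq_iff

theorem card_le_height_collapseIdeal {σ K : Type*} [DecidableEq σ] [Field K] (g : σ → σ)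
    (D : Finset σ) (hD : ∀ i ∈ D, g i ∉ D) :
    (D.card : ℕ∞) ≤ (collapseIdeal K fun i => if i ∈ D then g i else i).height := by
  induction D using Finset.induction_on with
  | empty => simp
  | insert a D ha ih =>
    have ih := ih fun i hi h => hD i (Finset.mem_insert_of_mem hi) (Finset.mem_insert_of_mem h)
    rw [Finset.card_insert_of_notMem ha, Nat.cast_add, Nat.cast_one]
    refine (add_le_add_left ih 1).trans
      (Ideal.height_add_one_le_of_lt_of_isPrime (lt_of_le_of_ne ?_ ?_))
    · refine collapseIdeal_le_of_comp_eq (funext fun i => ?_)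
      by_cases hi : i ∈ D
      · have := hD i (Finset.mem_insert_of_mem hi)
        simp [hi, -Finset.mem_insert, this, Finset.mem_insert_of_mem hi]
      · simp [hi]
    · intro h
      have hga := hD a (Finset.mem_insert_self a D)
      have hmem : (MvPolynomial.X a - MvPolynomial.X (g a) : MvPolynomial σ K) ∈
          collapseIdeal K fun i => if i ∈ insert a D then g i else i := by
        rw [X_sub_X_mem_collapseIdeal_iff]
        simp [hga]
      rw [← h, X_sub_X_mem_collapseIdeal_iff] at hmem
      simp only [Finset.mem_insert, not_or] at hga
      simp only [ha, hga.2, if_false] at hmem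
      exact hga.1 hmem.symm

theorem card_ne_le_height_collapseIdeal {σ K : Type*} [Fintype σ] [DecidableEq σ] [Field K]
    (g : σ → σ) (hg : ∀ i, g (g i) = g i) :
    ((Finset.univ.filter fun i => g i ≠ i).card : ℕ∞) ≤ (collapseIdeal K g).height := by
  convert card_le_height_collapseIdeal (K := K) g (Finset.univ.filter fun i => g i ≠ i)
    (fun i _ => by simp [hg]) using 3
  funext i
  by_cases hi : g i = i <;> simp [hi]

/-- If the weighted power sums of `t` vanish in all degrees less than the number of values of `t`,
then the weights sum to zero on every fibre of `t`. -/
theorem sum_fiber_eq_zero_of_sum_mul_pow_eq_zero {σ K : Type*} [Fintype σ] [DecidableEq K]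
    [Field K] (c t : σ → K)
    (h : ∀ ν < (Finset.univ.image t).card, ∑ i, c i * t i ^ ν = 0) (x : K) :
    ∑ i with t i = x, c i = 0 := by
  by_cases hx : x ∈ Finset.univ.image t
  · set q : Polynomial K := ∏ y ∈ (Finset.univ.image t).erase x, (Polynomial.X - Polynomial.C y)
    have hdeg : q.natDegree < (Finset.univ.image t).card := by
      rw [Polynomial.natDegree_prod_of_monic _ _ fun y _ => Polynomial.monic_X_sub_C y]
      simpa using Finset.card_erase_lt_of_mem hx
    have hsum : ∑ i, c i * q.eval (t i) = 0 := by
      simp_rw [Polynomial.eval_eq_sum_range' hdeg, Finset.mul_sum]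
      rw [Finset.sum_comm]
      refine Finset.sum_eq_zero fun ν hν => ?_
      rw [← mul_zero (q.coeff ν), ← h ν (Finset.mem_range.mp hν), Finset.mul_sum]
      exact Finset.sum_congr rfl fun i _ => by ring
    have hqx : q.eval x ≠ 0 := by
      rw [Polynomial.eval_prod, Finset.prod_ne_zero_iff]
      intro y hy
      simpa [sub_eq_zero] using (Finset.ne_of_mem_erase hy).symm
    have hsum' : (∑ i with t i = x, c i) * q.eval x = 0 := by
      rw [← hsum, Finset.sum_mul, Finset.sum_filter]
      refine Finset.sum_congr rfl fun i _ => ?_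
      split_ifs with hi
      · rw [hi]
      · symm
        rw [Polynomial.eval_prod, Finset.prod_eq_zero (i := t i), mul_zero]
        · exact Finset.mem_erase.mpr ⟨hi, Finset.mem_image_of_mem t (Finset.mem_univ i)⟩
        · simp
    exact (mul_eq_zero.mp hsum').resolve_right hqx
  · refine Finset.sum_eq_zero fun i hi => absurd ?_ hx
    rw [← (Finset.mem_filter.mp hi).2]
    exact Finset.mem_image_of_mem t (Finset.mem_univ i)

theorem sum_mul_pow_mul_char {σ K : Type*} [Fintype σ] {p : ℕ} [Fact p.Prime] [Field K] [CharP K p]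
    (w : σ → ZMod p) (t : σ → K) (ν : ℕ) :
    ∑ i, ZMod.castHom (dvd_refl p) K (w i) * t i ^ (p * ν) =
      (∑ i, ZMod.castHom (dvd_refl p) K (w i) * t i ^ ν) ^ p := by
  rw [sum_pow_char]
  refine Finset.sum_congr rfl fun i _ => ?_
  rw [mul_pow, ← map_pow, ZMod.pow_card, ← pow_mul, mul_comm p ν]

theorem sum_mul_pow_eq_zero_of_not_dvd_s6 {σ K : Type*} [Fintype σ] {p : ℕ} [Fact p.Prime] [Field K]
    [CharP K p] (w : σ → ZMod p) (t : σ → K) (m : ℕ)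
    (h : ∀ ν, 1 ≤ ν → ν < m → ¬ p ∣ ν → ∑ i, ZMod.castHom (dvd_refl p) K (w i) * t i ^ ν = 0)
    (ν : ℕ) (hν : 1 ≤ ν) (hνm : ν < m) :
    ∑ i, ZMod.castHom (dvd_refl p) K (w i) * t i ^ ν = 0 := by
  have hp : p.Prime := Fact.out
  induction ν using Nat.strong_induction_on with
  | _ ν ih =>
    by_cases hd : p ∣ ν
    · obtain ⟨μ, rfl⟩ := hd
      have hμ : 1 ≤ μ := Nat.one_le_iff_ne_zero.mpr fun h => by simp [h] at hν
      have hlt : μ < p * μ := lt_mul_of_one_lt_left hμ hp.one_lt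
      rw [sum_mul_pow_mul_char, ih μ hlt hμ (hlt.trans hνm), zero_pow hp.ne_zero]
    · exact h ν hν hνm hd

theorem card_filter_not_dvd_Ico {p m : ℕ} (hm : 1 ≤ m) (hpm : ¬ p ∣ m) :
    ((Finset.Ico 1 m).filter fun ν => ¬ p ∣ ν).card + m / p + 1 = m := by
  have h1 : insert m ((Finset.Ico 1 m).filter fun ν => ¬ p ∣ ν) =
      (Finset.Ioc 0 m).filter fun ν => ¬ p ∣ ν := by
    ext ν
    simp only [Finset.mem_insert, Finset.mem_filter, Finset.mem_Ico, Finset.mem_Ioc]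
    constructor
    · rintro (rfl | h)
      · exact ⟨⟨hm, le_rfl⟩, hpm⟩
      · exact ⟨⟨h.1.1, h.1.2.le⟩, h.2⟩
    · rintro ⟨⟨h1, h2⟩, h3⟩
      rcases h2.eq_or_lt with h | h
      · exact Or.inl h
      · exact Or.inr ⟨⟨h1, h⟩, h3⟩
  have h2 := Finset.card_filter_add_card_filter_not (s := Finset.Ioc 0 m) (fun ν => p ∣ ν)
  rw [Nat.Ioc_filter_dvd_card_eq_div, ← h1, Finset.card_insert_of_notMem (by simp),
    Nat.card_Ioc] at h2
  omega

theorem exists_injective_of_maximal_collapse {σ K : Type*} [Fintype σ] [DecidableEq σ] {p : ℕ}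
    [Fact p.Prime] [Field K] [IsAlgClosed K] [CharP K p] (w : σ → ZMod p) (hw : ∑ i, w i = 0)
    {m : ℕ} (hm : 1 ≤ m) (hpm : ¬ p ∣ m) (hcardσ : Fintype.card σ = m + 1)
    (g : σ → σ) (hg : ∀ i, g (g i) = g i) (hgw : ∀ j, ∑ i with g i = j, w i = 0)
    (hmax : ∀ f : σ → σ, (∀ j, ∑ i with f i = j, w i = 0) → (∀ i, g (f i) = g i) → f ∘ g = f)
    (hcard : (Finset.univ.filter fun i => g i = i).card ≤ m / p + 1) :
    ∃ t : σ → K, Function.Injective t ∧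
      (∀ ν, 1 ≤ ν → ν < m → ∑ i, ZMod.castHom (dvd_refl p) K (w i) * t i ^ ν = 0) ∧
      ∑ i, ZMod.castHom (dvd_refl p) K (w i) * t i ^ m ≠ 0 := by
  classical
  by_contra! hcon
  set φ := ZMod.castHom (dvd_refl p) K with hφ
  set F : ℕ → MvPolynomial σ K := fun ν => ∑ i, MvPolynomial.C (φ (w i)) * MvPolynomial.X i ^ ν
  set S := (Finset.Ico 1 m).filter fun ν => ¬ p ∣ ν with hS
  set I : Ideal (MvPolynomial σ K) := Ideal.span ((S.image F : Finset _) : Set _)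
  set T : Finset (σ → σ) := Finset.univ.filter fun f =>
    (∀ i, f (f i) = f i) ∧ ∀ j, ∑ i with f i = j, w i = 0
  have hF : ∀ (t : σ → K) ν, MvPolynomial.aeval t (F ν) = ∑ i, φ (w i) * t i ^ ν := by
    intro t ν
    simp [F]
  have hsol : ∀ t ∈ MvPolynomial.zeroLocus K I, ∃ f ∈ T, t ∘ f = t := by
    intro t ht
    have hpow : ∀ ν, 1 ≤ ν → ν < m → ∑ i, φ (w i) * t i ^ ν = 0 :=
      sum_mul_pow_eq_zero_of_not_dvd_s6 w t m fun ν h1 h2 h3 => by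
        rw [← hφ, ← hF]
        refine ht _ (Ideal.subset_span ?_)
        exact Finset.mem_coe.mpr (Finset.mem_image_of_mem F (by simp [hS, h1, h2, h3]))
    have hsmall : ∀ ν < (Finset.univ.image t).card, ∑ i, φ (w i) * t i ^ ν = 0 := by
      intro ν hν
      have hle : (Finset.univ.image t).card ≤ m + 1 := by
        rw [← hcardσ]; exact Finset.card_image_le
      rcases Nat.eq_zero_or_pos ν with rfl | h0
      · simp [← map_sum, hw]
      rcases lt_or_ge ν m with h | h
      · exact hpow ν h0 h
      · obtain rfl : ν = m := by omega
        refine hcon t ?_ hpow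
        rw [← Set.injOn_univ, ← Finset.coe_univ, ← Finset.card_image_iff, Finset.card_univ]
        omega
    obtain ⟨r, hr⟩ : ∃ r : K → σ, ∀ i, t (r (t i)) = t i := by
      have : Nonempty σ := Fintype.card_pos_iff.mp (by omega)
      exact ⟨Function.invFun t, fun i => Function.invFun_eq ⟨i, rfl⟩⟩
    refine ⟨fun i => r (t i), ?_, funext hr⟩
    refine Finset.mem_filter.mpr ⟨Finset.mem_univ _, fun i => congrArg r (hr i),
      fun j => φ.injective ?_⟩
    by_cases hj : r (t j) = j
    · rw [map_zero, map_sum,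
        ← sum_fiber_eq_zero_of_sum_mul_pow_eq_zero (fun i => φ (w i)) t hsmall (t j)]
      refine Finset.sum_congr (Finset.filter_congr fun i _ => ⟨fun h => ?_, fun h => ?_⟩)
        fun _ _ => rfl
      · rw [← h, hr]
      · change r (t i) = j
        rw [h, hj]
    · rw [Finset.filter_false_of_mem, Finset.sum_empty]
      rintro i - rfl
      exact hj (by rw [hr])
  have hTI : T.inf (collapseIdeal K) ≤ I.radical := by
    rw [← MvPolynomial.vanishingIdeal_zeroLocus_eq_radical (K := K)]
    intro q hq t ht
    obtain ⟨f, hf, hft⟩ := hsol t ht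
    have hq' : MvPolynomial.rename f q = 0 := (Finset.inf_le hf : _ ≤ collapseIdeal K f) hq
    rw [← hft, ← MvPolynomial.aeval_rename, hq', map_zero]
  have hmin : collapseIdeal K g ∈ I.minimalPrimes := by
    refine ⟨⟨inferInstance, ?_⟩, ?_⟩
    · rw [Ideal.span_le]
      intro q hq
      obtain ⟨ν, -, rfl⟩ := Finset.mem_image.mp (Finset.mem_coe.mp hq)
      change MvPolynomial.rename g (F ν) = 0
      simp only [F, map_sum, map_mul, map_pow, MvPolynomial.rename_C, MvPolynomial.rename_X]
      rw [← Finset.sum_fiberwise _ g]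
      refine Finset.sum_eq_zero fun j _ => ?_
      rw [Finset.sum_congr rfl fun i hi => by rw [(Finset.mem_filter.mp hi).2],
        ← Finset.sum_mul, ← map_sum, ← map_sum, hgw, map_zero, map_zero, zero_mul]
    · rintro 𝔮 ⟨h𝔮, hI𝔮⟩ h𝔮g
      obtain ⟨f, hf, hf𝔮⟩ := h𝔮.inf_le'.mp (hTI.trans (h𝔮.radical_le_iff.mpr hI𝔮))
      refine (collapseIdeal_le_of_comp_eq ?_).trans hf𝔮
      obtain ⟨hff, hfw⟩ := (Finset.mem_filter.mp hf).2
      exact hmax f hfw fun i => X_sub_X_mem_collapseIdeal_iff.mp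
        (h𝔮g (hf𝔮 (X_sub_X_mem_collapseIdeal_iff.mpr (hff i))))
  have hle := (card_ne_le_height_collapseIdeal (K := K) g hg).trans
    (Ideal.height_le_card_of_mem_minimalPrimes_span_finset hmin)
  have hle' := (Nat.cast_le.mp hle).trans Finset.card_image_le
  have hS' := card_filter_not_dvd_Ico hm hpm
  rw [← hS] at hS'
  have hsplit := Finset.card_filter_add_card_filter_not (s := Finset.univ) (fun i => g i = i)
  rw [Finset.card_univ, hcardσ] at hsplit
  simp only [ne_eq] at hle'
  omega

theorem exists_injective_of_adapted_maximal_finpartition {σ K : Type*} [Fintype σ] [DecidableEq σ]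
    {p : ℕ} [Fact p.Prime] [Field K] [IsAlgClosed K] [CharP K p] (w : σ → ZMod p)
    {m : ℕ} (hm : 1 ≤ m) (hpm : ¬ p ∣ m) (hcardσ : Fintype.card σ = m + 1)
    (P : Finpartition (Finset.univ : Finset σ)) (hP : ∀ B ∈ P.parts, ∑ i ∈ B, w i = 0)
    (hPmax : ∀ Q : Finpartition (Finset.univ : Finset σ), (∀ B ∈ Q.parts, ∑ i ∈ B, w i = 0) →
      (∀ B' ∈ Q.parts, ∃ B ∈ P.parts, B' ⊆ B) → Q = P)
    (hcard : P.parts.card ≤ m / p + 1) :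
    ∃ t : σ → K, Function.Injective t ∧
      (∀ ν, 1 ≤ ν → ν < m → ∑ i, ZMod.castHom (dvd_refl p) K (w i) * t i ^ ν = 0) ∧
      ∑ i, ZMod.castHom (dvd_refl p) K (w i) * t i ^ m ≠ 0 := by
  classical
  have hrep : ∀ B : Finset σ, ∃ b, B.Nonempty → b ∈ B := fun B => by
    have : Nonempty σ := Fintype.card_pos_iff.mp (by omega)
    by_cases hB : B.Nonempty
    · exact ⟨hB.choose, fun h => h.choose_spec⟩
    · exact ⟨Classical.arbitrary σ, fun h => absurd h hB⟩
  choose r hr using hrep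
  set g : σ → σ := fun i => r (P.part i)
  have hgmem : ∀ i, g i ∈ P.part i := fun i =>
    hr _ ⟨i, P.mem_part (Finset.mem_univ i)⟩
  have hpart : ∀ i j, i ∈ P.part j → P.part i = P.part j := fun i j h =>
    P.part_eq_of_mem (P.part_mem.mpr (Finset.mem_univ j)) h
  have hg : ∀ i, g (g i) = g i := fun i => congrArg r (hpart _ _ (hgmem i))
  have hgiff : ∀ i j, g i = g j ↔ i ∈ P.part j := fun i j => by
    refine ⟨fun h => ?_, fun h => congrArg r (hpart _ _ h)⟩
    rw [← hpart _ _ (hgmem j), ← h, hpart _ _ (hgmem i)]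
    exact P.mem_part (Finset.mem_univ i)
  refine exists_injective_of_maximal_collapse w ?_ hm hpm hcardσ g hg ?_ ?_ ?_
  · have h := Finset.sum_biUnion (f := w) P.disjoint
    rw [← Finset.sup_eq_biUnion, P.sup_parts] at h
    exact h.trans (Finset.sum_eq_zero hP)
  · intro j
    by_cases hj : g j = j
    · rw [← hP (P.part j) (P.part_mem.mpr (Finset.mem_univ j))]
      refine Finset.sum_congr (Finset.ext fun i => ?_) fun _ _ => rfl
      rw [← hgiff, hj]
      simp
    · rw [Finset.filter_false_of_mem, Finset.sum_empty]
      rintro i - rfl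
      exact hj (hg i)
  · intro f hfw hgf
    set Q : Finpartition (Finset.univ : Finset σ) := Finpartition.ofSetoid (Setoid.ker f)
    have hQ : ∀ a b, b ∈ Q.part a ↔ f a = f b := fun a b =>
      Finpartition.mem_part_ofSetoid_iff_rel
    have hQpart : ∀ B ∈ Q.parts, ∃ a, Q.part a = B := fun B hB => by
      obtain ⟨a, ha⟩ := Q.nonempty_of_mem_parts hB
      exact ⟨a, Q.part_eq_of_mem hB ha⟩
    have hQP : Q = P := by
      refine hPmax Q (fun B hB => ?_) fun B hB => ?_
      · obtain ⟨a, rfl⟩ := hQpart B hB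
        rw [← hfw (f a)]
        refine Finset.sum_congr (Finset.ext fun i => ?_) fun _ _ => rfl
        rw [hQ, eq_comm]
        simp
      · obtain ⟨a, rfl⟩ := hQpart B hB
        refine ⟨P.part a, P.part_mem.mpr (Finset.mem_univ a), fun b hb => ?_⟩
        rw [← hgiff, ← hgf, ← (hQ a b).mp hb, hgf]
    funext i
    exact ((hQ i (g i)).mp (hQP ▸ hgmem i)).symm
  · refine le_trans (Finset.card_le_card_of_injOn P.part
      (fun i _ => P.part_mem.mpr (Finset.mem_univ i)) fun i hi j hj h => ?_) hcard
    rw [← (Finset.mem_filter.mp hi).2, ← (Finset.mem_filter.mp hj).2]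
    exact congrArg r h


/-- additive realizability criterion. With `I = I' ⊕ J`,
`e = (m'_a mod p)` on `I'` and `−1` on `J`, if there exists a maximal `e`-adapted partition
of `I` with at most `⌊m/p⌋ + 1` blocks, then there exists an injective family `t : I → k`
with `∑ i, e i * t i ^ ν = 0` for all `1 ≤ ν ≤ m − 1` and `∑ i, e i * t i ^ m ≠ 0`. -/
theorem stmt_6 {p : ℕ} (hp : p.Prime) (k : Type*) [Field k] [IsAlgClosed k] [CharP k p]
    (I' : Type*) [Fintype I'] [DecidableEq I'] [Nonempty I']
    (m' : I' → ℕ) (hm'pos : ∀ a, 0 < m' a) (hm'p : ∀ a, ¬ p ∣ m' a)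
    (m : ℕ) (hmdef : m = (∑ a, (m' a + 1)) - 1) (hm : 1 ≤ m) (hpm : ¬ p ∣ m)
    (J : Type*) [Fintype J] [DecidableEq J]
    (hJ : Fintype.card J = m + 1 - Fintype.card I')
    (e : I' ⊕ J → ZMod p)
    (hedef : e = Sum.elim (fun a => ((m' a : ZMod p))) (fun _ => (-1 : ZMod p)))
    (P : Finpartition (Finset.univ : Finset (I' ⊕ J)))
    (hPad : ∀ B ∈ P.parts, ∑ i ∈ B, e i = 0)
    (hPmax : ∀ Q : Finpartition (Finset.univ : Finset (I' ⊕ J)),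
      (∀ B ∈ Q.parts, ∑ i ∈ B, e i = 0) →
      (∀ B' ∈ Q.parts, ∃ B ∈ P.parts, B' ⊆ B) → Q = P)
    (hcard : P.parts.card ≤ m / p + 1) :
    ∃ t : I' ⊕ J → k, Function.Injective t ∧
      (∀ ν : ℕ, 1 ≤ ν → ν ≤ m - 1 →
        ∑ i, (ZMod.castHom (dvd_refl p) k (e i)) * t i ^ ν = 0) ∧
      ∑ i, (ZMod.castHom (dvd_refl p) k (e i)) * t i ^ m ≠ 0 := by
  classical
  have := Fact.mk hp
  have hle : 2 * Fintype.card I' ≤ ∑ a, (m' a + 1) := by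
    rw [mul_comm, ← smul_eq_mul, ← Finset.card_univ]
    exact Finset.card_nsmul_le_sum _ _ _ fun a _ => Nat.succ_le_succ (hm'pos a)
  have hI' : 0 < Fintype.card I' := Fintype.card_pos
  have hcardσ : Fintype.card (I' ⊕ J) = m + 1 := by
    rw [Fintype.card_sum]
    omega
  obtain ⟨t, hinj, hpow, htop⟩ := exists_injective_of_adapted_maximal_finpartition (K := k) e hm hpm
    hcardσ P hPad hPmax hcard
  exact ⟨t, hinj, fun ν h1 h2 => hpow ν h1 (by omega), htop⟩
end
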